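/- Let n ≥ 1 and define the hyperbolic Laplacian L on functions on H = ℝ^n × (0, ∞) by (Lf)(x,y) = y²·(Δf)(x,y) − (n−1)·y·(∂_y f)(x,y). For every natural number m ≥ 1 and every real c > (n/2)^{4m}, there exists a nonzero smooth function f : ℝ^n × ℝ → ℝ with compact support contained in H such that ∫_H (L^m f)(x,y)² · y^{−n−1} dx dy < c · ∫_H f(x,y)² · y^{−n−1} dx dy. -/

import Mathlib

open MeasureTheory

noncomputable section

/-- The `i`-th horizontal coordinate direction in `ℝ^n × ℝ`. -/
def ex (n : ℕ) (i : Fin n) : (Fin n → ℝ) × ℝ := (Pi.single i 1, 0)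

/-- The vertical coordinate direction in `ℝ^n × ℝ`. -/
def ey (n : ℕ) : (Fin n → ℝ) × ℝ := (0, 1)

/-- Partial derivative in the direction `v`. -/
def pderiv' (n : ℕ) (v : (Fin n → ℝ) × ℝ) (f : (Fin n → ℝ) × ℝ → ℝ) :
    (Fin n → ℝ) × ℝ → ℝ := fun p => fderiv ℝ f p v

/-- The Euclidean Laplacian on `ℝ^n × ℝ`: the sum of the second partial
derivatives in all `n+1` variables. -/
def eucLap (n : ℕ) (f : (Fin n → ℝ) × ℝ → ℝ) : (Fin n → ℝ) × ℝ → ℝ := fun p =>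
  (∑ i, pderiv' n (ex n i) (pderiv' n (ex n i) f) p) +
    pderiv' n (ey n) (pderiv' n (ey n) f) p

/-- The squared norm of the Euclidean gradient of `f` on `ℝ^n × ℝ`. -/
def gradSq (n : ℕ) (f : (Fin n → ℝ) × ℝ → ℝ) : (Fin n → ℝ) × ℝ → ℝ := fun p =>
  (∑ i, (pderiv' n (ex n i) f p) ^ 2) + (pderiv' n (ey n) f p) ^ 2

/-- The hyperbolic Laplacian of the upper half-space model:
`(Lf)(x,y) = y²·(Δf)(x,y) − (n−1)·y·(∂_y f)(x,y)`. -/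
def hypLap (n : ℕ) (f : (Fin n → ℝ) × ℝ → ℝ) : (Fin n → ℝ) × ℝ → ℝ := fun p =>
  p.2 ^ 2 * eucLap n f p - ((n : ℝ) - 1) * p.2 * pderiv' n (ey n) f p

/-- The open upper half-space `H = ℝ^n × (0, ∞)`. -/
def upperH (n : ℕ) : Set ((Fin n → ℝ) × ℝ) := {p | 0 < p.2}

end

section PolynomialFamilies

variable {V : Type*} [AddCommGroup V] [Module ℝ V]

theorem continuous_bilin_pow_add_smul (B : V →ₗ[ℝ] V →ₗ[ℝ] ℝ) (P Q : Module.End ℝ V)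
    (a b : ℕ) (f g : V) :
    Continuous fun s : ℝ => B (((P + s • Q) ^ a) f) (((P + s • Q) ^ b) g) := by
  induction a generalizing f with
  | zero =>
    induction b generalizing g with
    | zero => simpa using continuous_const
    | succ b ih =>
      simp only [pow_succ, Module.End.mul_apply, LinearMap.add_apply, LinearMap.smul_apply,
        map_add, map_smul, smul_eq_mul]
      exact (ih (P g)).add (continuous_id.mul (ih (Q g)))
  | succ a ih =>
    simp only [pow_succ _ a, Module.End.mul_apply, LinearMap.add_apply, LinearMap.smul_apply,
      map_add, map_smul, smul_eq_mul]
    exact (ih (P f)).add (continuous_id.mul (ih (Q f)))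

theorem exists_pos_bilin_pow_add_smul_lt (B : V →ₗ[ℝ] V →ₗ[ℝ] ℝ) (P Q : Module.End ℝ V)
    (m : ℕ) (f : V) {K : ℝ} (h : B ((P ^ m) f) ((P ^ m) f) < K) :
    ∃ s : ℝ, 0 < s ∧ B (((P + s ^ 2 • Q) ^ m) f) (((P + s ^ 2 • Q) ^ m) f) < K := by
  have hc : Continuous fun s : ℝ => B (((P + s ^ 2 • Q) ^ m) f) (((P + s ^ 2 • Q) ^ m) f) :=
    (continuous_bilin_pow_add_smul B P Q m m f f).comp (continuous_pow 2)
  have h0 : ∀ᶠ s in nhds (0 : ℝ),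
      B (((P + s ^ 2 • Q) ^ m) f) (((P + s ^ 2 • Q) ^ m) f) < K :=
    hc.continuousAt.eventually_lt continuousAt_const (by simpa using h)
  obtain ⟨s, hs, hpos⟩ :=
    ((h0.filter_mono nhdsWithin_le_nhds).and (self_mem_nhdsWithin (s := Set.Ioi 0))).exists
  exact ⟨s, hpos, hs⟩

end PolynomialFamilies

noncomputable section

section TestFunctions

variable {E : Type*} [NormedAddCommGroup E] [NormedSpace ℝ E]

variable (E) in
/-- The space of smooth compactly supported real functions. -/
def testSpace : Submodule ℝ (E → ℝ) where
  carrier := {f | ContDiff ℝ (⊤ : ℕ∞) f ∧ HasCompactSupport f}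
  add_mem' hf hg := ⟨hf.1.add hg.1, hf.2.add hg.2⟩
  zero_mem' := ⟨contDiff_const, HasCompactSupport.zero⟩
  smul_mem' c _ hf := ⟨hf.1.const_smul c, hf.2.smul_left (f := fun _ => c)⟩

namespace testSpace

theorem contDiff (f : testSpace E) : ContDiff ℝ (⊤ : ℕ∞) f.1 := f.2.1

theorem hasCompactSupport (f : testSpace E) : HasCompactSupport f.1 := f.2.2

theorem continuous (f : testSpace E) : Continuous f.1 := (contDiff f).continuous

theorem differentiable (f : testSpace E) : Differentiable ℝ f.1 :=
  (contDiff f).differentiable (by simp)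

/-- Directional derivative of test functions. -/
def dirDeriv (v : E) : Module.End ℝ (testSpace E) where
  toFun f := ⟨fun p => fderiv ℝ f.1 p v,
    ((contDiff f).fderiv_right (m := (⊤ : ℕ∞)) (by simp)).clm_apply contDiff_const,
    (hasCompactSupport f).fderiv_apply ℝ v⟩
  map_add' f g := by
    ext p
    exact congrArg (· v) (fderiv_add ((differentiable f) p) ((differentiable g) p))
  map_smul' c f := by
    ext p
    exact congrArg (· v) (fderiv_const_smul ((differentiable f) p) c)

/-- Multiplication of test functions by a smooth function. -/
def smoothMul (h : E → ℝ) (hh : ContDiff ℝ (⊤ : ℕ∞) h) : Module.End ℝ (testSpace E) where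
  toFun f := ⟨h * f.1, hh.mul (contDiff f), (hasCompactSupport f).mul_left⟩
  map_add' f g := by
    ext p
    exact mul_add (h p) _ _
  map_smul' c f := by
    ext p
    exact mul_left_comm (h p) c _

/-- Precomposition of a test function with a linear automorphism. -/
def comp (σ : E ≃L[ℝ] E) (f : testSpace E) : testSpace E :=
  ⟨f.1 ∘ σ, (contDiff f).comp σ.contDiff, (hasCompactSupport f).comp_homeomorph σ.toHomeomorph⟩

theorem dirDeriv_comp (σ : E ≃L[ℝ] E) (f : testSpace E) {v : E} {a : ℝ} (hv : σ v = a • v) :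
    dirDeriv v (comp σ f) = a • comp σ (dirDeriv v f) := by
  ext p
  have h := ((differentiable f) (σ p)).hasFDerivAt.comp p σ.hasFDerivAt
  change fderiv ℝ (f.1 ∘ σ) p v = a * fderiv ℝ f.1 (σ p) v
  rw [h.fderiv]
  simp [hv]

theorem comp_add (σ : E ≃L[ℝ] E) (f g : testSpace E) : comp σ (f + g) = comp σ f + comp σ g :=
  rfl

theorem comp_smul (σ : E ≃L[ℝ] E) (c : ℝ) (f : testSpace E) : comp σ (c • f) = c • comp σ f :=
  rfl

theorem comp_pow {P P' : Module.End ℝ (testSpace E)} {σ : E ≃L[ℝ] E}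
    (h : ∀ f, P (comp σ f) = comp σ (P' f)) (m : ℕ) (f : testSpace E) :
    (P ^ m) (comp σ f) = comp σ ((P' ^ m) f) := by
  induction m generalizing f with
  | zero => rfl
  | succ m ih => simp only [pow_succ, Module.End.mul_apply, h, ih]

variable [MeasurableSpace E] [BorelSpace E] (μ : Measure E)

theorem integrable_mul [IsFiniteMeasureOnCompacts μ] (f g : testSpace E) : Integrable (fun p => f.1 p * g.1 p) μ :=
  ((continuous f).mul (continuous g)).integrable_of_hasCompactSupport (hasCompactSupport g).mul_left

/-- The `L²` inner product on test functions. -/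
def inner [IsFiniteMeasureOnCompacts μ] : testSpace E →ₗ[ℝ] testSpace E →ₗ[ℝ] ℝ :=
  LinearMap.mk₂ ℝ (fun f g => ∫ p, f.1 p * g.1 p ∂μ)
    (fun f f' g => by
      rw [← integral_add (integrable_mul μ f g) (integrable_mul μ f' g)]
      exact integral_congr_ae (.of_forall fun p => add_mul _ _ _))
    (fun c f g => by
      rw [smul_eq_mul, ← integral_const_mul]
      exact integral_congr_ae (.of_forall fun p => mul_assoc _ _ _))
    (fun f g g' => by
      rw [← integral_add (integrable_mul μ f g) (integrable_mul μ f g')]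
      exact integral_congr_ae (.of_forall fun p => mul_add _ _ _))
    (fun c f g => by
      rw [smul_eq_mul, ← integral_const_mul]
      exact integral_congr_ae (.of_forall fun p => mul_left_comm _ _ _))

theorem inner_apply [IsFiniteMeasureOnCompacts μ] (f g : testSpace E) : inner μ f g = ∫ p, f.1 p * g.1 p ∂μ := rfl

theorem inner_self_pos [IsFiniteMeasureOnCompacts μ] [μ.IsOpenPosMeasure] {f : testSpace E} (hf : f ≠ 0) :
    0 < inner μ f f := by
  obtain ⟨p, hp⟩ : ∃ p, f.1 p ≠ 0 := by
    by_contra! h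
    exact hf (Subtype.ext (funext h))
  exact ((continuous f).mul (continuous f)).integral_pos_of_hasCompactSupport_nonneg_nonzero
    (hasCompactSupport f).mul_left (fun q => mul_self_nonneg (f.1 q)) (mul_self_ne_zero.2 hp)

theorem exists_inner_comp [FiniteDimensional ℝ E] [μ.IsAddHaarMeasure] (σ : E ≃L[ℝ] E) :
    ∃ κ : ℝ, 0 < κ ∧ ∀ f : testSpace E,
      inner μ (comp σ f) (comp σ f) = κ * inner μ f f := by
  have hdet : LinearMap.det (σ.toLinearEquiv : E →ₗ[ℝ] E) ≠ 0 :=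
    (LinearEquiv.isUnit_det' σ.toLinearEquiv).ne_zero
  refine ⟨|(LinearMap.det (σ.toLinearEquiv : E →ₗ[ℝ] E))⁻¹|, by positivity, fun f => ?_⟩
  have h := σ.toHomeomorph.measurableEmbedding.integral_map (μ := μ)
    (fun p => f.1 p * f.1 p)
  have hmap : Measure.map σ.toHomeomorph μ =
      ENNReal.ofReal |(LinearMap.det (σ.toLinearEquiv : E →ₗ[ℝ] E))⁻¹| • μ :=
    Measure.map_linearMap_addHaar_eq_smul_addHaar μ hdet
  rw [hmap, integral_smul_measure, ENNReal.toReal_ofReal (abs_nonneg _)] at h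
  exact h.symm

/-- Given operators satisfying a strict energy bound at `P`, an operator that a family of
rescalings conjugates to `P + s² Q` satisfies it on some rescaled function. -/
theorem exists_comp_inner_lt [FiniteDimensional ℝ E] [μ.IsAddHaarMeasure]
    (P Q R : Module.End ℝ (testSpace E)) (σ : ∀ s : ℝ, 0 < s → E ≃L[ℝ] E)
    (hσ : ∀ s hs f, R (comp (σ s hs) f) = comp (σ s hs) ((P + s ^ 2 • Q) f))
    (m : ℕ) {f : testSpace E} {c : ℝ}
    (h : inner μ ((P ^ m) f) ((P ^ m) f) < c * inner μ f f) :
    ∃ g, inner μ ((R ^ m) g) ((R ^ m) g) < c * inner μ g g := by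
  obtain ⟨s, hs, hlt⟩ := exists_pos_bilin_pow_add_smul_lt (inner μ) P Q m f h
  obtain ⟨κ, hκ, hin⟩ := exists_inner_comp μ (σ s hs)
  refine ⟨comp (σ s hs) f, ?_⟩
  rw [comp_pow (hσ s hs), hin, hin]
  nlinarith [mul_lt_mul_of_pos_left hlt hκ]

end testSpace

end TestFunctions

section UpperHalfSpace

open testSpace

variable (n : ℕ)

/-- The automorphism of `ℝ^n × ℝ` scaling the two factors by `a` and `b`. -/
def scaling (a b : ℝ) (ha : a ≠ 0) (hb : b ≠ 0) :
    ((Fin n → ℝ) × ℝ) ≃L[ℝ] ((Fin n → ℝ) × ℝ) :=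
  (ContinuousLinearEquiv.smulLeft (Units.mk0 a ha)).prodCongr
    (ContinuousLinearEquiv.smulLeft (Units.mk0 b hb))

variable {n} in
theorem scaling_apply {a b : ℝ} (ha : a ≠ 0) (hb : b ≠ 0) (p : (Fin n → ℝ) × ℝ) :
    scaling n a b ha hb p = (a • p.1, b • p.2) := rfl

theorem scaling_ex {a b : ℝ} (ha : a ≠ 0) (hb : b ≠ 0) (i : Fin n) :
    scaling n a b ha hb (ex n i) = a • ex n i := by
  simp [scaling_apply, ex]

theorem scaling_ey {a b : ℝ} (ha : a ≠ 0) (hb : b ≠ 0) :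
    scaling n a b ha hb (ey n) = b • ey n := by
  simp [scaling_apply, ey]

/-- The second derivative in the last variable. -/
def vertLap : Module.End ℝ (testSpace ((Fin n → ℝ) × ℝ)) := dirDeriv (ey n) * dirDeriv (ey n)

/-- Multiplication by `e^{2t}`. -/
def mulExp : Module.End ℝ (testSpace ((Fin n → ℝ) × ℝ)) :=
  smoothMul (fun p => Real.exp (2 * p.2)) (by fun_prop)

/-- The operator `e^{2t} Δ_x`. -/
def horLap : Module.End ℝ (testSpace ((Fin n → ℝ) × ℝ)) :=
  mulExp n * ∑ i, dirDeriv (ex n i) * dirDeriv (ex n i)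

/-- The hyperbolic Laplacian conjugated by `g ↦ y^{n/2} g(x, log y)`. -/
def logHypLap : Module.End ℝ (testSpace ((Fin n → ℝ) × ℝ)) :=
  (-((n : ℝ) ^ 2 / 4)) • 1 + vertLap n + horLap n

theorem vertLap_comp_scaling {a b : ℝ} (ha : a ≠ 0) (hb : b ≠ 0)
    (f : testSpace ((Fin n → ℝ) × ℝ)) :
    vertLap n (comp (scaling n a b ha hb) f) =
      comp (scaling n a b ha hb) (b ^ 2 • vertLap n f) := by
  simp only [vertLap, Module.End.mul_apply, dirDeriv_comp _ _ (scaling_ey n ha hb), map_smul,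
    smul_smul, comp_smul, sq]

theorem horLap_comp_scaling {a : ℝ} (ha : a ≠ 0) (f : testSpace ((Fin n → ℝ) × ℝ)) :
    horLap n (comp (scaling n a 1 ha one_ne_zero) f) =
      comp (scaling n a 1 ha one_ne_zero) (a ^ 2 • horLap n f) := by
  simp only [horLap, Module.End.mul_apply, LinearMap.sum_apply,
    dirDeriv_comp _ _ (scaling_ex n ha one_ne_zero _), map_smul, smul_smul, ← Finset.smul_sum,
    comp_smul, sq]
  congr 1
  ext p
  simp [mulExp, smoothMul, comp, scaling_apply]

instance isAddHaarMeasure_volume : (volume : Measure ((Fin n → ℝ) × ℝ)).IsAddHaarMeasure :=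
  Measure.prod.instIsAddHaarMeasure _ _

theorem exists_logHypLap_inner_lt (m : ℕ) {c : ℝ} (hc : ((n : ℝ) / 2) ^ (4 * m) < c) :
    ∃ g, inner volume ((logHypLap n ^ m) g) ((logHypLap n ^ m) g) < c * inner volume g g := by
  obtain ⟨φ, -, hφc, hφs, -, hφ⟩ :=
    exists_contDiff_tsupport_subset (n := (⊤ : ℕ∞)) (x := (0 : (Fin n → ℝ) × ℝ)) Filter.univ_mem
  let f₀ : testSpace ((Fin n → ℝ) × ℝ) := ⟨φ, hφs, hφc⟩
  have hf₀ : f₀ ≠ 0 := fun h => by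
    have : φ = 0 := congrArg Subtype.val h
    simp [this] at hφ
  have hpos : 0 < inner volume f₀ f₀ := inner_self_pos volume hf₀
  let P₀ : Module.End ℝ (testSpace ((Fin n → ℝ) × ℝ)) := (-((n : ℝ) ^ 2 / 4)) • 1
  have h₀ : inner volume ((P₀ ^ m) f₀) ((P₀ ^ m) f₀) < c * inner volume f₀ f₀ := by
    have hP : (P₀ ^ m) f₀ = (-((n : ℝ) ^ 2 / 4)) ^ m • f₀ := by
      simp [P₀, smul_pow]
    have hpow : (-((n : ℝ) ^ 2 / 4)) ^ m * (-((n : ℝ) ^ 2 / 4)) ^ m =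
        ((n : ℝ) / 2) ^ (4 * m) := by
      rw [← mul_pow, pow_mul]
      ring
    rw [hP, map_smul, map_smul, LinearMap.smul_apply, smul_smul, hpow, smul_eq_mul]
    exact mul_lt_mul_of_pos_right hc hpos
  obtain ⟨f₁, h₁⟩ := exists_comp_inner_lt volume P₀ (vertLap n) (P₀ + vertLap n)
    (fun s hs => scaling n 1 s one_ne_zero hs.ne')
    (fun s hs f => by
      simp only [LinearMap.add_apply, vertLap_comp_scaling, comp_add, LinearMap.smul_apply]
      rfl) m h₀
  exact exists_comp_inner_lt volume (P₀ + vertLap n) (horLap n) (logHypLap n)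
    (fun s hs => scaling n s 1 hs.ne' one_ne_zero)
    (fun s hs f => by
      simp only [logHypLap, LinearMap.add_apply, vertLap_comp_scaling, comp_add,
        LinearMap.smul_apply, horLap_comp_scaling, one_pow, one_smul]
      rfl) m h₁

variable {n}

/-- The function `y^a g(x, log y)` on the upper half-space, extended by zero. -/
def powLift (a : ℝ) (g : testSpace ((Fin n → ℝ) × ℝ)) : (Fin n → ℝ) × ℝ → ℝ := fun p =>
  if 0 < p.2 then p.2 ^ a * g.1 (p.1, Real.log p.2) else 0

variable (a : ℝ) (g : testSpace ((Fin n → ℝ) × ℝ))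

theorem powLift_of_pos {p : (Fin n → ℝ) × ℝ} (hp : 0 < p.2) :
    powLift a g p = p.2 ^ a * g.1 (p.1, Real.log p.2) := if_pos hp

theorem powLift_of_nonpos {p : (Fin n → ℝ) × ℝ} (hp : ¬ 0 < p.2) : powLift a g p = 0 :=
  if_neg hp

theorem isCompact_exp_image_tsupport :
    IsCompact ((fun p : (Fin n → ℝ) × ℝ => (p.1, Real.exp p.2)) '' tsupport g.1) :=
  (hasCompactSupport g).isCompact.image (by fun_prop)

theorem tsupport_powLift_subset :
    tsupport (powLift a g) ⊆
      (fun p : (Fin n → ℝ) × ℝ => (p.1, Real.exp p.2)) '' tsupport g.1 := by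
  refine closure_minimal (fun p hp => ?_) (isCompact_exp_image_tsupport g).isClosed
  have hpos : 0 < p.2 := by
    by_contra h
    exact hp (powLift_of_nonpos a g h)
  refine ⟨(p.1, Real.log p.2), subset_tsupport _ fun h => hp ?_, by simp [Real.exp_log hpos]⟩
  rw [powLift_of_pos a g hpos, h, mul_zero]

theorem tsupport_powLift_subset_upperH : tsupport (powLift a g) ⊆ upperH n :=
  (tsupport_powLift_subset a g).trans <| Set.image_subset_iff.2 fun p _ => Real.exp_pos p.2

theorem hasCompactSupport_powLift : HasCompactSupport (powLift a g) :=
  (isCompact_exp_image_tsupport g).of_isClosed_subset (isClosed_tsupport _)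
    (tsupport_powLift_subset a g)

theorem isOpen_upperH : IsOpen (upperH n) := isOpen_lt continuous_const continuous_snd

theorem powLift_eventuallyEq {p : (Fin n → ℝ) × ℝ} (hp : 0 < p.2) :
    powLift a g =ᶠ[nhds p] fun q => q.2 ^ a * g.1 (q.1, Real.log q.2) :=
  Filter.eventuallyEq_of_mem (isOpen_upperH.mem_nhds hp) fun _ hq => powLift_of_pos a g hq

theorem contDiff_powLift : ContDiff ℝ (⊤ : ℕ∞) (powLift a g) := by
  refine contDiff_iff_contDiffAt.2 fun p => ?_
  by_cases hp : p ∉ tsupport (powLift a g)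
  · exact contDiffAt_const.congr_of_eventuallyEq (notMem_tsupport_iff_eventuallyEq.1 hp)
  have hpos : 0 < p.2 := tsupport_powLift_subset_upperH a g (not_not.1 hp)
  refine ContDiffAt.congr_of_eventuallyEq ?_ (powLift_eventuallyEq a g hpos)
  exact (contDiffAt_snd.rpow_const_of_ne hpos.ne').mul
    ((contDiff g).contDiffAt.comp p (contDiffAt_fst.prodMk (contDiffAt_snd.log hpos.ne')))

theorem pderiv'_powLift_of_nonpos (v : (Fin n → ℝ) × ℝ) {p : (Fin n → ℝ) × ℝ}
    (hp : ¬ 0 < p.2) : pderiv' n v (powLift a g) p = 0 := by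
  rw [pderiv', fderiv_of_notMem_tsupport ℝ fun h => hp (tsupport_powLift_subset_upperH a g h)]
  rfl

theorem pderiv'_powLift_of_pos (v : (Fin n → ℝ) × ℝ) {p : (Fin n → ℝ) × ℝ} (hp : 0 < p.2) :
    pderiv' n v (powLift a g) p =
      p.2 ^ a * fderiv ℝ g.1 (p.1, Real.log p.2) (v.1, p.2⁻¹ * v.2) +
        a * p.2 ^ (a - 1) * v.2 * g.1 (p.1, Real.log p.2) := by
  have h₁ : HasFDerivAt (fun q : (Fin n → ℝ) × ℝ => q.2 ^ a) _ p :=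
    (hasFDerivAt_snd (𝕜 := ℝ)).rpow_const (Or.inl hp.ne')
  have h₂ : HasFDerivAt (fun q : (Fin n → ℝ) × ℝ => (q.1, Real.log q.2)) _ p :=
    hasFDerivAt_fst.prodMk ((hasFDerivAt_snd (𝕜 := ℝ)).log hp.ne')
  have h₃ := (differentiable g (p.1, Real.log p.2)).hasFDerivAt.comp p h₂
  have h := (h₁.mul h₃).congr_of_eventuallyEq (powLift_eventuallyEq a g hp)
  rw [pderiv', h.fderiv]
  simp
  ring

theorem pderiv'_ex_powLift (i : Fin n) :
    pderiv' n (ex n i) (powLift a g) = powLift a (dirDeriv (ex n i) g) := by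
  funext p
  by_cases hp : 0 < p.2
  · rw [pderiv'_powLift_of_pos a g _ hp, powLift_of_pos _ _ hp]
    have hv : ((ex n i).1, p.2⁻¹ * (ex n i).2) = ex n i := by simp [ex]
    rw [hv]
    simp [dirDeriv, ex]
  · rw [pderiv'_powLift_of_nonpos a g _ hp, powLift_of_nonpos _ _ hp]

theorem pderiv'_ey_powLift :
    pderiv' n (ey n) (powLift a g) = powLift (a - 1) (dirDeriv (ey n) g + a • g) := by
  funext p
  by_cases hp : 0 < p.2
  · rw [pderiv'_powLift_of_pos a g _ hp, powLift_of_pos _ _ hp]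
    have hv : ((ey n).1, p.2⁻¹ * (ey n).2) = p.2⁻¹ • ey n := by simp [ey]
    rw [hv, map_smul, Real.rpow_sub_one hp.ne']
    change _ = p.2 ^ a / p.2 * (fderiv ℝ g.1 (p.1, Real.log p.2) (ey n) +
      a * g.1 (p.1, Real.log p.2))
    simp only [ey, smul_eq_mul]
    ring
  · rw [pderiv'_powLift_of_nonpos a g _ hp, powLift_of_nonpos _ _ hp]

theorem hypLap_powLift : hypLap n (powLift (n / 2) g) = powLift (n / 2) (logHypLap n g) := by
  funext p
  simp only [hypLap, eucLap, pderiv'_ex_powLift, pderiv'_ey_powLift]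
  by_cases hp : 0 < p.2
  · simp only [powLift_of_pos _ _ hp, Real.rpow_sub_one hp.ne']
    have hexp : Real.exp (2 * Real.log p.2) = p.2 ^ 2 := by
      rw [two_mul, Real.exp_add, Real.exp_log hp, sq]
    have hM : (logHypLap n g).1 (p.1, Real.log p.2) =
        -((n : ℝ) ^ 2 / 4) * g.1 (p.1, Real.log p.2) +
          (dirDeriv (ey n) (dirDeriv (ey n) g)).1 (p.1, Real.log p.2) +
          p.2 ^ 2 * ∑ i, (dirDeriv (ex n i) (dirDeriv (ex n i) g)).1 (p.1, Real.log p.2) := by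
      simp [logHypLap, vertLap, horLap, mulExp, smoothMul, hexp, Finset.mul_sum]
    rw [hM]
    simp only [map_add, map_smul, Submodule.coe_add, Submodule.coe_smul, Pi.add_apply,
      Pi.smul_apply, smul_eq_mul]
    rw [← Finset.mul_sum]
    field_simp
    ring
  · simp [powLift_of_nonpos _ _ hp]

theorem iterate_hypLap_powLift (m : ℕ) :
    (hypLap n)^[m] (powLift (n / 2) g) = powLift (n / 2) ((logHypLap n ^ m) g) := by
  rw [Module.End.pow_apply]
  exact ((Function.Semiconj.iterate_right (f := powLift (n / 2 : ℝ))
    (fun g => (hypLap_powLift g).symm) m) g).symm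

theorem integral_powLift_neg_one : ∫ p in upperH n, powLift (-1) g p = ∫ p, g.1 p := by
  have hvanish : ∀ p ∉ upperH n, powLift (-1) g p = 0 := fun p hp => powLift_of_nonpos _ g hp
  rw [setIntegral_eq_integral_of_forall_compl_eq_zero hvanish, Measure.volume_eq_prod,
    integral_prod _ ((contDiff_powLift _ g).continuous.integrable_of_hasCompactSupport
      (hasCompactSupport_powLift _ g)),
    integral_prod _ ((continuous g).integrable_of_hasCompactSupport (hasCompactSupport g))]
  congr 1
  funext x
  have h := integral_image_eq_integral_abs_deriv_smul MeasurableSet.univ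
    (fun t _ => (Real.hasDerivAt_exp t).hasDerivWithinAt) Real.exp_injective.injOn
    (fun y => powLift (-1) g (x, y))
  rw [Set.image_univ, Real.range_exp, setIntegral_univ,
    setIntegral_eq_integral_of_forall_compl_eq_zero (s := Set.Ioi 0)
      (fun y hy => powLift_of_nonpos (-1) g (p := (x, y)) hy)] at h
  rw [h]
  congr 1
  funext t
  rw [powLift_of_pos _ _ (Real.exp_pos t), Real.log_exp, Real.rpow_neg_one, Real.abs_exp,
    smul_eq_mul, mul_inv_cancel_left₀ (Real.exp_ne_zero t)]

theorem integral_powLift_sq :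
    ∫ q in upperH n, powLift (n / 2) g q ^ 2 * q.2 ^ (-(n : ℝ) - 1) =
      inner volume g g := by
  let g₂ : testSpace ((Fin n → ℝ) × ℝ) := smoothMul g.1 (contDiff g) g
  rw [inner_apply, ← show ∫ p, g₂.1 p = ∫ p, g.1 p * g.1 p from rfl, ← integral_powLift_neg_one]
  refine setIntegral_congr_fun isOpen_upperH.measurableSet fun q hq => ?_
  have hq : 0 < q.2 := hq
  have hexp : (q.2 ^ ((n : ℝ) / 2)) ^ 2 * q.2 ^ (-(n : ℝ) - 1) = q.2 ^ (-1 : ℝ) := by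
    rw [← Real.rpow_natCast, ← Real.rpow_mul hq.le, ← Real.rpow_add hq]
    congr 1
    push_cast
    ring
  simp only [powLift_of_pos _ _ hq, ← hexp]
  change _ = _ * (g.1 _ * g.1 _)
  ring

end UpperHalfSpace

end

/-- sharpness of the even-order clamped polyharmonic bound on
hyperbolic space: for `m ≥ 1` and every `c > (n/2)^{4m}` there is a nonzero
`f ∈ C_c^∞(H)` with `∫_H (L^m f)² y^{−n−1} < c · ∫_H f² y^{−n−1}`. -/
theorem stmt13 (n : ℕ) (hn : 1 ≤ n) (m : ℕ) (hm : 1 ≤ m)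
    (c : ℝ) (hc : ((n : ℝ) / 2) ^ (4 * m) < c) :
    ∃ f : (Fin n → ℝ) × ℝ → ℝ, ContDiff ℝ (⊤ : ℕ∞) f ∧ HasCompactSupport f ∧
      tsupport f ⊆ upperH n ∧ f ≠ 0 ∧
      ∫ q in upperH n, ((hypLap n)^[m] f q) ^ 2 * q.2 ^ (-(n : ℝ) - 1) <
        c * ∫ q in upperH n, f q ^ 2 * q.2 ^ (-(n : ℝ) - 1) := by
  obtain ⟨g, hg⟩ := exists_logHypLap_inner_lt n m hc
  have key : ∫ q in upperH n, ((hypLap n)^[m] (powLift (n / 2) g) q) ^ 2 * q.2 ^ (-(n : ℝ) - 1) <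
      c * ∫ q in upperH n, powLift (n / 2) g q ^ 2 * q.2 ^ (-(n : ℝ) - 1) := by
    rwa [iterate_hypLap_powLift, integral_powLift_sq, integral_powLift_sq]
  refine ⟨powLift (n / 2) g, contDiff_powLift _ g, hasCompactSupport_powLift _ g,
    tsupport_powLift_subset_upperH _ g, fun h => key.not_ge ?_, key⟩
  rw [h]
  simp only [Pi.zero_apply, ne_eq, OfNat.ofNat_ne_zero, not_false_eq_true, zero_pow, zero_mul,
    integral_zero, mul_zero]
  refine setIntegral_nonneg isOpen_upperH.measurableSet fun q hq => ?_
  exact mul_nonneg (sq_nonneg _) (Real.rpow_nonneg (le_of_lt hq) _)
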